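/- arXiv:1212.6102 — 2 statements merged into one kernel-verified Lean document; each statement's English description precedes it below -/
import Mathlib

section
/- (Fine–Wilf) If S = X^i and T = Y^j, where X and Y are nonempty sequences and i, j ≥ 1, have a common suffix U of length |U| ≥ |X| + |Y| − gcd(|X|, |Y|), then there exist a sequence Z and integers g, h ≥ 1 such that X = Z^g, Y = Z^h, and |Z| = gcd(|X|, |Y|). -/
/-- `listPow Y k` is the sequence `Y` repeated `k` times (i.e. `Y^k`). -/
def listPow {α : Type*} (Y : List α) : ℕ → List α
  | 0 => []
  | k + 1 => Y ++ listPow Y k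

/-- The curling number of a finite sequence `S`: the largest `k` such that
`S = X ++ Y^k` for some (possibly empty) `X` and nonempty `Y`. -/
noncomputable def CN {α : Type*} (S : List α) : ℕ :=
  sSup {k | ∃ X Y : List α, Y ≠ [] ∧ S = X ++ listPow Y k}

/-- A nonempty sequence is primitive if it is not a power `T^i` with `i ≥ 2`. -/
def Primitive {α : Type*} (S : List α) : Prop :=
  S ≠ [] ∧ ∀ (T : List α) (i : ℕ), 2 ≤ i → S ≠ listPow T i

/-- `T` is a proper suffix of `S`: a suffix which is strictly shorter than `S`. -/
def ProperSuffix {α : Type*} (T S : List α) : Prop := T <:+ S ∧ T.length < S.length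

/-- A sequence `S` with curling number `k` is robust if no proper suffix of
`S^(k+1)` has curling number `≥ k + 1`. -/
def Robust {α : Type*} (S : List α) : Prop :=
  ∀ T : List α, ProperSuffix T (listPow S (CN S + 1)) → CN T ≤ CN S

theorem length_listPow {α : Type*} (X : List α) (k : ℕ) :
    (listPow X k).length = k * X.length := by
  induction k with
  | zero => simp [listPow]
  | succ k ih => simp [listPow, ih]; ring

theorem listPow_prefix_listPow_succ {α : Type*} (X : List α) (k : ℕ) :
    listPow X k <+: listPow X (k + 1) := by
  induction k with
  | zero => simp [listPow]
  | succ k ih => exact (List.prefix_append_right_inj X).mpr ih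

theorem suffix_listPow {α : Type*} (X : List α) {k : ℕ} (hk : 1 ≤ k) :
    X <:+ listPow X k := by
  induction k, hk using Nat.le_induction with
  | base => simp [listPow]
  | succ k _ ih => exact List.suffix_append_of_suffix ih

theorem hasPeriod_listPow {α : Type*} (X : List α) (k : ℕ) :
    (listPow X k).HasPeriod X.length := by
  cases k with
  | zero => simp [listPow]
  | succ k =>
    have h := (List.prefix_append_right_inj X).mpr (listPow_prefix_listPow_succ X k)
    simpa [List.HasPeriod, listPow] using h

theorem eq_listPow_take_of_hasPeriod {α : Type*} {p k : ℕ} {w : List α}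
    (hw : w.HasPeriod p) (hlen : w.length = k * p) : w = listPow (w.take p) k := by
  induction k generalizing w with
  | zero => simpa [listPow] using hlen
  | succ k ih =>
    have hpre := hw.drop_prefix
    have hdrop : (w.drop p).length = k * p := by
      rw [List.length_drop, hlen, Nat.succ_mul, Nat.add_sub_cancel]
    have hpow := ih (hw.infix hpre.isInfix) hdrop
    have htake : listPow ((w.drop p).take p) k = listPow (w.take p) k := by
      cases k with
      | zero => rfl
      | succ k =>
        obtain ⟨t, ht⟩ := hpre
        congr 1
        conv_rhs => rw [← ht]
        rw [List.take_append_of_le_length]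
        rw [hdrop, Nat.succ_mul]
        exact Nat.le_add_left _ _
    rw [htake] at hpow
    rw [listPow, ← hpow, List.take_append_drop]

theorem exists_eq_listPow_of_suffix_of_hasPeriod {α : Type*} {X U : List α} {d : ℕ}
    (hX : X ≠ []) (hXU : X <:+ U) (hU : U.HasPeriod d) (hd : d ∣ X.length) :
    ∃ g, 1 ≤ g ∧ X = listPow (U.drop (U.length - d)) g := by
  obtain ⟨g, hg⟩ := hd
  have hpos : 0 < X.length := List.length_pos_iff.mpr hX
  have hg1 : 1 ≤ g := by
    rcases Nat.eq_zero_or_pos g with rfl | h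
    · simp_all
    · exact h
  have hdX : d ≤ X.length := hg ▸ Nat.le_mul_of_pos_right d hg1
  have hpow := eq_listPow_take_of_hasPeriod (hU.infix hXU.isInfix) (hg.trans (mul_comm d g))
  have hsuf : X.take d <:+ U := by
    have h := suffix_listPow (X.take d) hg1
    rw [← hpow] at h
    exact h.trans hXU
  have hroot : X.take d = U.drop (U.length - d) := by
    rw [List.suffix_iff_eq_drop.mp hsuf, List.length_take, min_eq_left hdX]
  exact ⟨g, hg1, hroot ▸ hpow⟩

/-- Fine–Wilf theorem: if `X^i` and `Y^j` have a common suffix `U` with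
`|U| ≥ |X| + |Y| - gcd(|X|,|Y|)`, then `X` and `Y` are powers of a common word `Z`
of length `gcd(|X|,|Y|)`. -/
theorem fine_wilf {α : Type*} (X Y U : List α) (i j : ℕ)
    (hX : X ≠ []) (hY : Y ≠ []) (hi : 1 ≤ i) (hj : 1 ≤ j)
    (hUX : U <:+ listPow X i) (hUY : U <:+ listPow Y j)
    (hlen : X.length + Y.length - Nat.gcd X.length Y.length ≤ U.length) :
    ∃ (Z : List α) (g h : ℕ), 1 ≤ g ∧ 1 ≤ h ∧ X = listPow Z g ∧ Y = listPow Z h ∧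
      Z.length = Nat.gcd X.length Y.length := by
  have hdX := Nat.gcd_le_left Y.length (List.length_pos_iff.mpr hX)
  have hdY := Nat.gcd_le_right X.length (List.length_pos_iff.mpr hY)
  have hU : U.HasPeriod (Nat.gcd X.length Y.length) :=
    ((hasPeriod_listPow X i).infix hUX.isInfix).gcd
      ((hasPeriod_listPow Y j).infix hUY.isInfix) hlen
  have hXU : X <:+ U := List.suffix_of_suffix_length_le (suffix_listPow X hi) hUX (by lia)
  have hYU : Y <:+ U := List.suffix_of_suffix_length_le (suffix_listPow Y hj) hUY (by lia)
  obtain ⟨g, hg, hXg⟩ :=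
    exists_eq_listPow_of_suffix_of_hasPeriod hX hXU hU (Nat.gcd_dvd_left _ _)
  obtain ⟨h, hh, hYh⟩ :=
    exists_eq_listPow_of_suffix_of_hasPeriod hY hYU hU (Nat.gcd_dvd_right _ _)
  exact ⟨_, g, h, hg, hh, hXg, hYh, by rw [List.length_drop]; lia⟩
end

section
/- For integers n and i with 1 ≤ i < n/3, a(n,i) = c(n,1) − Σ_{m = ⌈(n−i)/2⌉}^{⌊(n−1)/2⌋} b(m, n−2m). -/
/-- `c(n,k)`: the number of binary sequences of length `n` with curling number `k`. -/
noncomputable def cCount (n k : ℕ) : ℕ :=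
  {S : List Bool | S.length = n ∧ CN S = k}.ncard

/-- `p(n,k)`: the number of primitive binary sequences of length `n` with curling number `k`. -/
noncomputable def pCount (n k : ℕ) : ℕ :=
  {S : List Bool | S.length = n ∧ CN S = k ∧ Primitive S}.ncard

/-- `p'(n,k)`: the number of primitive robust binary sequences of length `n`
with curling number `k`. -/
noncomputable def pCount' (n k : ℕ) : ℕ :=
  {S : List Bool | S.length = n ∧ CN S = k ∧ Primitive S ∧ Robust S}.ncard

/-- `q(n,k) = Σ_{i=1}^{k} p(n,i)`. -/
noncomputable def qCount (n k : ℕ) : ℕ := ∑ i ∈ Finset.Icc 1 k, pCount n i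

/-- `S^{[i]}`: the suffix of `S` of length `i`. -/
def suffLen {α : Type*} (S : List α) (i : ℕ) : List α := S.drop (S.length - i)

/-- `A(n,i)`: binary sequences `S` of length `n` with `CN S = 1` and `CN (S^{[i]} S) = 1`. -/
def setA (n i : ℕ) : Set (List Bool) :=
  {S | S.length = n ∧ CN S = 1 ∧ CN (suffLen S i ++ S) = 1}

/-- `B(n,i)`: binary sequences `S` of length `n` with `CN S = 1` and `CN (S S^{[i]} S) = 1`. -/
def setB (n i : ℕ) : Set (List Bool) :=
  {S | S.length = n ∧ CN S = 1 ∧ CN (S ++ suffLen S i ++ S) = 1}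

/-- `E(n,i,j)`: binary sequences `S` of length `n` with `CN S = 1`
and `S^{[i]} S ∈ B(n+i, j)`. -/
def setE (n i j : ℕ) : Set (List Bool) :=
  {S | S.length = n ∧ CN S = 1 ∧ (suffLen S i ++ S) ∈ setB (n + i) j}

noncomputable def aCount (n i : ℕ) : ℕ := (setA n i).ncard
noncomputable def bCount (n i : ℕ) : ℕ := (setB n i).ncard
noncomputable def eCount (n i j : ℕ) : ℕ := (setE n i j).ncard

theorem listPow_length {α : Type*} (Y : List α) (k : ℕ) :
    (listPow Y k).length = k * Y.length := by
  induction k with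
  | zero => simp [listPow]
  | succ k ih => simp [listPow, ih, Nat.succ_mul, Nat.add_comm]

theorem listPow_succ_right {α : Type*} (Y : List α) (k : ℕ) :
    listPow Y (k + 1) = listPow Y k ++ Y := by
  induction k with
  | zero => simp [listPow]
  | succ k ih =>
    rw [listPow, ih, ← List.append_assoc, ← listPow, ih]

/-- A nonempty sequence has curling number `1` iff no nonempty square is a suffix of it. -/
theorem CN_eq_one_iff {α : Type*} {S : List α} (hS : S ≠ []) :
    CN S = 1 ↔ ∀ Y : List α, Y ≠ [] → ¬ (Y ++ Y <:+ S) := by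
  have hb : BddAbove {k | ∃ X Y : List α, Y ≠ [] ∧ S = X ++ listPow Y k} := by
    refine ⟨S.length, ?_⟩
    rintro k ⟨X, Y, hY, h⟩
    have hlen := congrArg List.length h
    rw [List.length_append, listPow_length] at hlen
    have := List.length_pos_iff.2 hY
    nlinarith
  have h1 : 1 ∈ {k | ∃ X Y : List α, Y ≠ [] ∧ S = X ++ listPow Y k} :=
    ⟨[], S, hS, by simp [listPow]⟩
  constructor
  · rintro h Y hY ⟨X, hX⟩
    have : 2 ≤ CN S := le_csSup hb ⟨X, Y, hY, by simp [listPow, ← hX]⟩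
    omega
  · intro h
    refine le_antisymm (csSup_le ⟨1, h1⟩ ?_) (le_csSup hb h1)
    rintro k ⟨X, Y, hY, hk⟩
    by_contra! hlt
    obtain ⟨l, rfl⟩ := Nat.exists_eq_add_of_le' (show 2 ≤ k from hlt)
    refine h Y hY ⟨X ++ listPow Y l, ?_⟩
    rw [hk, listPow_succ_right, listPow_succ_right]
    simp

theorem CN_eq_one_of_suffix {α : Type*} {S T : List α} (h : CN S = 1) (hTS : T <:+ S)
    (hT : T ≠ []) : CN T = 1 := by
  have hS : S ≠ [] := fun h0 => hT (by simpa [h0] using hTS)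
  rw [CN_eq_one_iff hT]
  exact fun Y hY hYT => (CN_eq_one_iff hS).1 h Y hY (hYT.trans hTS)

theorem suffLen_suffix {α : Type*} (S : List α) (i : ℕ) : suffLen S i <:+ S :=
  List.drop_suffix _ _

theorem length_suffLen {α : Type*} {S : List α} {i : ℕ} (h : i ≤ S.length) :
    (suffLen S i).length = i := by
  simp only [suffLen, List.length_drop]
  omega

theorem suffLen_eq_of_suffix {α : Type*} {S W : List α} (h : W <:+ S) :
    suffLen S W.length = W :=
  (List.suffix_iff_eq_drop.1 h).symm

/-- The sequence `Z Z^{[j]} Z`. -/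
def sandwich {α : Type*} (j : ℕ) (Z : List α) : List α := Z ++ suffLen Z j ++ Z

theorem length_sandwich {α : Type*} {j : ℕ} {Z : List α} (h : j ≤ Z.length) :
    (sandwich j Z).length = 2 * Z.length + j := by
  simp only [sandwich, List.length_append, length_suffLen h]
  omega

theorem suffix_sandwich {α : Type*} (j : ℕ) (Z : List α) : Z <:+ sandwich j Z :=
  List.suffix_append _ _

theorem prefix_sandwich {α : Type*} (j : ℕ) (Z : List α) : Z <+: sandwich j Z := by
  simp [sandwich, List.append_assoc]

/-- If prepending `S^{[i]}` to a sequence `S` of curling number `1` creates a square suffix,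
then `S` has the form `Z Z^{[j]} Z`. -/
theorem exists_sandwich {α : Type*} {S : List α} {i : ℕ} (h2 : 3 * i < S.length)
    (hS : CN S = 1) (hA : CN (suffLen S i ++ S) ≠ 1) :
    ∃ Z : List α, S.length ≤ 2 * Z.length + i ∧ 2 * Z.length < S.length ∧
      sandwich (S.length - 2 * Z.length) Z = S := by
  have hS0 : S ≠ [] := by rintro rfl; simp at h2
  have hl : (suffLen S i).length = i := length_suffLen (by omega)
  rw [Ne, CN_eq_one_iff (by simp [hS0])] at hA
  push Not at hA
  obtain ⟨Y, hY, hYY⟩ := hA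
  have hlen := hYY.length_le
  simp only [List.length_append, hl] at hlen
  have hSs : S <:+ suffLen S i ++ S := List.suffix_append _ _
  have hnot := (CN_eq_one_iff hS0).1 hS Y hY
  have hlt : S.length < Y.length + Y.length := by
    by_contra! hle
    exact hnot (List.suffix_of_suffix_length_le hYY hSs (by simpa using hle))
  have hSY : S <:+ Y ++ Y := List.suffix_of_suffix_length_le hSs hYY (by simp; omega)
  have hYS : Y <:+ S :=
    List.suffix_of_suffix_length_le (List.suffix_append _ _) hSY (by omega)
  obtain ⟨Z, rfl⟩ := hYS
  have hZY : Z <:+ Y := by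
    obtain ⟨X, hX⟩ := hSY
    rw [← List.append_assoc] at hX
    exact ⟨X, List.append_cancel_right hX⟩
  obtain ⟨W, rfl⟩ := hZY
  have hW : W <:+ suffLen (Z ++ (W ++ Z)) i := by
    obtain ⟨X, hX⟩ := hYY
    refine ⟨X, List.append_cancel_right (bs := Z ++ (W ++ Z)) ?_⟩
    rw [← hX]
    simp
  have hWl := hW.length_le
  rw [hl] at hWl
  simp only [List.length_append] at *
  have hWZ : W <:+ Z :=
    List.suffix_of_suffix_length_le (hW.trans (suffLen_suffix _ _))
      ⟨Z ++ W, by simp⟩ (by omega)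
  refine ⟨Z, by omega, by omega, ?_⟩
  rw [show Z.length + (W.length + Z.length) - 2 * Z.length = W.length by omega, sandwich,
    suffLen_eq_of_suffix hWZ, List.append_assoc]

theorem CN_suffLen_append_sandwich_ne_one {α : Type*} {Z : List α} {i j : ℕ} (hj : j ≤ i)
    (hjZ : j ≤ Z.length) (hi : i ≤ (sandwich j Z).length) (hZ : Z ≠ []) :
    CN (suffLen (sandwich j Z) i ++ sandwich j Z) ≠ 1 := by
  have hW : suffLen Z j <:+ suffLen (sandwich j Z) i :=
    List.suffix_of_suffix_length_le ((suffLen_suffix _ _).trans (suffix_sandwich _ _))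
      (suffLen_suffix _ _) (by rwa [length_suffLen hjZ, length_suffLen hi])
  obtain ⟨X, hX⟩ := hW
  intro h
  rw [CN_eq_one_iff (by simp [sandwich, hZ])] at h
  refine h (suffLen Z j ++ Z) (by simp [hZ]) ⟨X, ?_⟩
  rw [← hX]
  simp [sandwich]

/-- Two borders of a sequence of curling number `1` cannot have nearly equal lengths. -/
theorem two_mul_length_lt_of_borders {α : Type*} {S Z Z' : List α} (hS : CN S = 1)
    (hs : Z <:+ S) (hp : Z <+: S) (hs' : Z' <:+ S) (hp' : Z' <+: S)
    (hlt : Z.length < Z'.length) : 2 * Z.length < Z'.length := by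
  by_contra! hle
  have hS0 : S ≠ [] := by
    rintro rfl
    simp_all
  have hZs : Z <:+ Z' := List.suffix_of_suffix_length_le hs hs' hlt.le
  obtain ⟨V, rfl⟩ := List.prefix_of_prefix_length_le hp hp' hlt.le
  rw [List.length_append] at hlt hle
  obtain ⟨Q, rfl⟩ := List.suffix_of_suffix_length_le (List.suffix_append Z V) hZs (by omega)
  refine (CN_eq_one_iff hS0).1 hS V (List.length_pos_iff.1 (by omega)) (.trans ⟨Q, ?_⟩ hs')
  simp

theorem sandwich_injOn {α : Type*} (j m : ℕ) :
    Set.InjOn (sandwich j) {Z : List α | Z.length = m} := by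
  intro Z hZ Z' hZ' h
  have hl : Z.length = Z'.length := hZ.trans hZ'.symm
  exact (List.append_inj' h hl).2

theorem mem_setB_iff {m j : ℕ} (hm : 0 < m) {Z : List Bool} :
    Z ∈ setB m j ↔ Z.length = m ∧ CN (sandwich j Z) = 1 := by
  refine ⟨fun h => ⟨h.1, h.2.2⟩, fun h => ⟨h.1, ?_, h.2⟩⟩
  exact CN_eq_one_of_suffix h.2 (suffix_sandwich _ _) (List.length_pos_iff.1 (by omega))

theorem setOf_CN_eq_one_diff_setA {n i : ℕ} (h2 : 3 * i < n) :
    {S : List Bool | S.length = n ∧ CN S = 1} \ setA n i =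
      ⋃ m ∈ (Finset.Icc ((n - i + 1) / 2) ((n - 1) / 2) : Set ℕ),
        sandwich (n - 2 * m) '' setB m (n - 2 * m) := by
  ext S
  simp only [Set.mem_sdiff, Set.mem_ofPred_eq, setA, Set.mem_iUnion, Set.mem_image,
    Finset.mem_coe, Finset.mem_Icc, exists_prop]
  constructor
  · rintro ⟨⟨rfl, hS⟩, hA⟩
    obtain ⟨Z, hZ1, hZ2, hZ⟩ := exists_sandwich h2 hS (fun h => hA ⟨rfl, hS, h⟩)
    refine ⟨Z.length, by omega, Z, (mem_setB_iff (by omega)).2 ⟨rfl, ?_⟩, hZ⟩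
    rwa [hZ]
  · rintro ⟨m, hm, Z, hZ, rfl⟩
    obtain ⟨rfl, hZ⟩ := (mem_setB_iff (by omega)).1 hZ
    have hl := length_sandwich (show n - 2 * Z.length ≤ Z.length by omega)
    refine ⟨⟨by omega, hZ⟩, fun h => ?_⟩
    exact CN_suffLen_append_sandwich_ne_one (by omega) (by omega) (by omega)
      (List.length_pos_iff.1 (by omega)) h.2.2

theorem pairwiseDisjoint_sandwich {n i : ℕ} (h2 : 3 * i < n) :
    (Finset.Icc ((n - i + 1) / 2) ((n - 1) / 2) : Set ℕ).PairwiseDisjoint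
      (fun m => sandwich (n - 2 * m) '' setB m (n - 2 * m)) := by
  have key : ∀ m ∈ Finset.Icc ((n - i + 1) / 2) ((n - 1) / 2),
      ∀ m' ∈ Finset.Icc ((n - i + 1) / 2) ((n - 1) / 2), m < m' →
      Disjoint (sandwich (n - 2 * m) '' setB m (n - 2 * m))
        (sandwich (n - 2 * m') '' setB m' (n - 2 * m')) := by
    intro m hm m' hm' hlt
    rw [Finset.mem_Icc] at hm hm'
    rw [Set.disjoint_left]
    rintro _ ⟨Z, hZ, rfl⟩ ⟨Z', hZ', h⟩
    have := two_mul_length_lt_of_borders (S := sandwich (n - 2 * m) Z) hZ.2.2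
      (suffix_sandwich _ Z) (prefix_sandwich _ Z)
      (h ▸ suffix_sandwich _ Z') (h ▸ prefix_sandwich _ Z') (by rwa [hZ.1, hZ'.1])
    rw [hZ.1, hZ'.1] at this
    omega
  intro m hm m' hm' hne
  rcases lt_or_gt_of_ne hne with hlt | hlt
  · exact key m hm m' hm' hlt
  · exact (key m' hm' m hm hlt).symm

/-- For `1 ≤ i < n/3`: `a(n,i) = c(n,1) - Σ_{m=⌈(n-i)/2⌉}^{⌊(n-1)/2⌋} b(m, n-2m)`. -/
theorem aCount_formula_small_i (n i : ℕ) (h1 : 1 ≤ i) (h2 : 3 * i < n) :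
    (aCount n i : ℤ) = (cCount n 1 : ℤ) -
      ∑ m ∈ Finset.Icc ((n - i + 1) / 2) ((n - 1) / 2), (bCount m (n - 2 * m) : ℤ) := by
  have hfin : ∀ m j, (setB m j).Finite := fun m j =>
    (List.finite_length_eq Bool m).subset fun S hS => hS.1
  have hC : {S : List Bool | S.length = n ∧ CN S = 1}.Finite :=
    (List.finite_length_eq Bool n).subset fun S hS => hS.1
  have hsub : setA n i ⊆ {S : List Bool | S.length = n ∧ CN S = 1} :=
    fun S hS => ⟨hS.1, hS.2.1⟩
  have hcard := Set.ncard_sdiff_add_ncard_of_subset hsub hC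
  rw [setOf_CN_eq_one_diff_setA h2,
    Set.Finite.ncard_biUnion (Finset.finite_toSet _) (fun m _ => (hfin _ _).image _)
      (pairwiseDisjoint_sandwich h2), finsum_mem_coe_finset,
    Finset.sum_congr rfl fun m _ => Set.InjOn.ncard_image
      ((sandwich_injOn (n - 2 * m) m).mono fun Z hZ => hZ.1)] at hcard
  simp only [aCount, bCount, cCount, ← hcard]
  push_cast
  ring
end
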